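/- Let T = V₁ − V₂, where V₁ ~ χ'²_r(λ₁) and V₂ ~ χ'²_r(λ₂) are independent, with r > 0 and λ₁, λ₂ ≥ 0, and let W be a real-valued random variable with E|W| < ∞. Define the operator A₁ by A₁f(x) = 16x f⁗(x) + 16r f‴(x) − (8x + 4(λ₁−λ₂)) f″(x) − 4(λ₁+λ₂+r) f′(x) + (x − (λ₁−λ₂)) f(x). Then W has the same distribution as T if and only if E[A₁f(W)] = 0 for all f ∈ F₄(W). -/

import Mathlib

open MeasureTheory ProbabilityTheory Real

noncomputable section

/-- Modified Bessel function of the first kind,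
`I ν y = ∑_{k=0}^∞ (y/2)^{2k+ν} / (k! Γ(k+ν+1))`. -/
def besselI (ν y : ℝ) : ℝ :=
  ∑' k : ℕ, (y / 2) ^ (2 * (k : ℝ) + ν) / ((k.factorial : ℝ) * Real.Gamma ((k : ℝ) + ν + 1))

/-- The density of the noncentral chi-square distribution with `r` degrees of freedom and
noncentrality parameter `lam` (for `lam = 0`, the chi-square density). -/
def ncChiSqPdf (r lam x : ℝ) : ℝ :=
  if x ≤ 0 then 0
  else if lam = 0 then x ^ (r / 2 - 1) * Real.exp (-x / 2) / (2 ^ (r / 2) * Real.Gamma (r / 2))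
  else (1 / 2) * Real.exp (-(x + lam) / 2) * (x / lam) ^ (r / 4 - 1 / 2) *
    besselI (r / 2 - 1) (Real.sqrt (lam * x))

/-- The noncentral chi-square distribution `χ'²_r(lam)` as a measure on `ℝ`. -/
def ncChiSq (r lam : ℝ) : Measure ℝ :=
  volume.withDensity fun x => ENNReal.ofReal (ncChiSqPdf r lam x)

/-- The law of the difference `T = V₁ - V₂` of independent noncentral chi-square random
variables `V₁ ~ χ'²_r(λ₁)` and `V₂ ~ χ'²_r(λ₂)`. -/
def ncChiSqDiff (r lam1 lam2 : ℝ) : Measure ℝ :=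
  Measure.map (fun p : ℝ × ℝ => p.1 - p.2) ((ncChiSq r lam1).prod (ncChiSq r lam2))

open Filter Set
open scoped Topology ENNReal

lemma gammaPDFReal_of_pos {a ρ x : ℝ} (hx : 0 < x) :
    gammaPDFReal a ρ x = ρ ^ a / Gamma a * x ^ (a - 1) * exp (-(ρ * x)) := by
  simp [gammaPDFReal, hx.le]

lemma mul_gammaPDFReal {a ρ x : ℝ} (ha : 0 < a) (hρ : 0 < ρ) (hx : 0 < x) :
    x * gammaPDFReal a ρ x = a / ρ * gammaPDFReal (a + 1) ρ x := by
  have hΓ := Gamma_pos_of_pos ha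
  have hxa : x ^ (a + 1 - 1) = x * x ^ (a - 1) := by
    rw [mul_comm, ← rpow_add_one hx.ne']; ring_nf
  rw [gammaPDFReal_of_pos hx, gammaPDFReal_of_pos hx, Gamma_add_one ha.ne',
    rpow_add_one hρ.ne', hxa]
  field_simp

lemma gammaMeasure_eq_restrict (a ρ : ℝ) :
    gammaMeasure a ρ = (volume.restrict (Ioi 0)).withDensity (gammaPDF a ρ) := by
  have hm : Measurable (gammaPDF a ρ) := (measurable_gammaPDFReal a ρ).ennreal_ofReal
  rw [← restrict_withDensity measurableSet_Ioi, gammaMeasure, eq_comm,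
    Measure.restrict_eq_self_of_ae_mem]
  have h0 : ∀ᵐ x : ℝ, x ≠ 0 := by simp [ae_iff]
  rw [ae_withDensity_iff hm]
  filter_upwards [h0] with x hx0 hx
  by_contra hneg
  exact hx (gammaPDF_of_neg (lt_of_le_of_ne (not_lt.1 hneg) hx0))

lemma integrable_gammaMeasure_iff {a ρ : ℝ} (ha : 0 < a) (hρ : 0 < ρ) (f : ℝ → ℝ) :
    Integrable f (gammaMeasure a ρ) ↔
      IntegrableOn (fun x => gammaPDFReal a ρ x * f x) (Ioi 0) := by
  have hm : Measurable (gammaPDF a ρ) := (measurable_gammaPDFReal a ρ).ennreal_ofReal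
  rw [gammaMeasure_eq_restrict, integrable_withDensity_iff_integrable_smul' hm
    (by simp [gammaPDF]), IntegrableOn]
  simp [gammaPDF, ENNReal.toReal_ofReal (gammaPDFReal_nonneg ha hρ _)]

lemma integral_gammaMeasure {a ρ : ℝ} (ha : 0 < a) (hρ : 0 < ρ) (f : ℝ → ℝ) :
    ∫ x, f x ∂gammaMeasure a ρ = ∫ x in Ioi 0, gammaPDFReal a ρ x * f x := by
  have hm : Measurable (gammaPDF a ρ) := (measurable_gammaPDFReal a ρ).ennreal_ofReal
  rw [gammaMeasure_eq_restrict, integral_withDensity_eq_integral_toReal_smul hm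
    (by simp [gammaPDF])]
  simp [gammaPDF, ENNReal.toReal_ofReal (gammaPDFReal_nonneg ha hρ _)]

/-- Size biasing a gamma distribution increases its shape by one. -/
lemma integral_mul_gammaMeasure {a ρ : ℝ} (ha : 0 < a) (hρ : 0 < ρ) (f : ℝ → ℝ) :
    ∫ x, x * f x ∂gammaMeasure a ρ = a / ρ * ∫ x, f x ∂gammaMeasure (a + 1) ρ := by
  rw [integral_gammaMeasure ha hρ, integral_gammaMeasure (by linarith) hρ, ← integral_const_mul]
  refine setIntegral_congr_fun measurableSet_Ioi fun x hx => ?_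
  have := mul_gammaPDFReal ha hρ hx
  linear_combination f x * this

lemma integrable_id_gammaMeasure {a ρ : ℝ} (ha : 0 < a) (hρ : 0 < ρ) :
    Integrable (fun x => x) (gammaMeasure a ρ) := by
  have := isProbabilityMeasure_gammaMeasure (a := a + 1) (by linarith) hρ
  have h1 := ((integrable_gammaMeasure_iff (by linarith) hρ _).1
    (integrable_const (1 : ℝ) (μ := gammaMeasure (a + 1) ρ))).const_mul (a / ρ)
  rw [integrable_gammaMeasure_iff ha hρ]
  refine IntegrableOn.congr_fun h1 (fun x hx => ?_) measurableSet_Ioi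
  have := mul_gammaPDFReal ha hρ hx
  linear_combination -this

lemma integral_abs_gammaMeasure {a ρ : ℝ} (ha : 0 < a) (hρ : 0 < ρ) :
    ∫ x, ‖x‖ ∂gammaMeasure a ρ = a / ρ := by
  have := isProbabilityMeasure_gammaMeasure (a := a + 1) (by linarith) hρ
  have h := integral_mul_gammaMeasure ha hρ fun _ => 1
  simp only [mul_one, integral_const, probReal_univ, smul_eq_mul] at h
  rw [← h, integral_gammaMeasure ha hρ, integral_gammaMeasure ha hρ]
  refine setIntegral_congr_fun measurableSet_Ioi fun x hx => ?_
  simp [abs_of_pos (mem_Ioi.1 hx)]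

lemma integrable_of_continuous_bounded {μ : Measure ℝ} [IsFiniteMeasure μ] {f : ℝ → ℝ} {C : ℝ}
    (hf : Continuous f) (hC : ∀ x, |f x| ≤ C) : Integrable f μ :=
  .of_bound hf.aestronglyMeasurable C (.of_forall hC)

/-- Stein identity relating the gamma distributions with shapes `a` and `a + 1`. -/
lemma integral_gammaMeasure_add_one {a ρ C C' : ℝ} (ha : 0 < a) (hρ : 0 < ρ) {h h' : ℝ → ℝ}
    (hd : ∀ x, HasDerivAt h (h' x) x) (hc' : Continuous h') (hC : ∀ x, |h x| ≤ C)
    (hC' : ∀ x, |h' x| ≤ C') :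
    ∫ x, (h x - h' x / ρ) ∂gammaMeasure (a + 1) ρ = ∫ x, h x ∂gammaMeasure a ρ := by
  have ha1 : 0 < a + 1 := by linarith
  have := isProbabilityMeasure_gammaMeasure ha hρ
  have := isProbabilityMeasure_gammaMeasure ha1 hρ
  have hc : Continuous h := continuous_iff_continuousAt.2 fun x => (hd x).continuousAt
  have i1 := (integrable_gammaMeasure_iff ha hρ _).1 (integrable_of_continuous_bounded hc hC)
  have i2 : IntegrableOn (fun x => gammaPDFReal (a + 1) ρ x * (h x - h' x / ρ)) (Ioi 0) :=
    (integrable_gammaMeasure_iff ha1 hρ _).1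
      ((integrable_of_continuous_bounded hc hC).sub
        ((integrable_of_continuous_bounded hc' hC').div_const ρ))
  rw [integral_gammaMeasure ha hρ, integral_gammaMeasure ha1 hρ, eq_comm, ← sub_eq_zero,
    ← integral_sub i1 i2]
  set F : ℝ → ℝ := fun x => ρ ^ a / Gamma (a + 1) * (x ^ a * exp (-(ρ * x))) * h x with hF
  have hΓ := Gamma_pos_of_pos ha
  have key := integral_Ioi_of_hasDerivAt_of_tendsto (f := F) (a := 0) (m := 0)
    (f' := fun x => gammaPDFReal a ρ x * h x - gammaPDFReal (a + 1) ρ x * (h x - h' x / ρ))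
    ?_ ?_ (i1.sub i2) ?_
  · rw [key]; simp [hF, zero_rpow ha.ne']
  · refine Continuous.continuousWithinAt ?_
    have : Continuous fun x : ℝ => x ^ a := continuous_rpow_const ha.le
    fun_prop
  · intro x hx
    have hx : 0 < x := hx
    have e1 : HasDerivAt (fun x : ℝ => x ^ a) (a * x ^ (a - 1)) x :=
      hasDerivAt_rpow_const (Or.inl hx.ne')
    have e2 : HasDerivAt (fun x : ℝ => exp (-(ρ * x))) (exp (-(ρ * x)) * (-(ρ * 1))) x :=
      (((hasDerivAt_id x).const_mul ρ).neg).exp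
    refine (((e1.mul e2).const_mul (ρ ^ a / Gamma (a + 1))).mul (hd x)).congr_deriv ?_
    have hxa : x ^ a = x * x ^ (a - 1) := by
      rw [mul_comm, ← rpow_add_one hx.ne']; ring_nf
    rw [gammaPDFReal_of_pos hx, gammaPDFReal_of_pos hx, Gamma_add_one ha.ne',
      rpow_add_one hρ.ne', add_sub_cancel_right]
    simp only [Pi.mul_apply]
    rw [hxa]
    field_simp
    ring
  · have t := (tendsto_rpow_mul_exp_neg_mul_atTop_nhds_zero a ρ hρ).const_mul
      (ρ ^ a / Gamma (a + 1))
    rw [mul_zero] at t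
    have hb : IsBoundedUnder (· ≤ ·) atTop (norm ∘ h) :=
      isBoundedUnder_of ⟨C, hC⟩
    have t2 := t.zero_mul_isBoundedUnder_le hb
    refine t2.congr fun x => ?_
    simp [hF]

/-- The Poisson weight of mean `lam / 2`, extended to `lam = 0`. -/
def poissonWeight (lam : ℝ) (k : ℕ) : ℝ :=
  exp (-lam / 2) * ((lam / 2) ^ k / (k.factorial : ℝ))

lemma poissonWeight_nonneg {lam : ℝ} (hl : 0 ≤ lam) (k : ℕ) : 0 ≤ poissonWeight lam k := by
  unfold poissonWeight; positivity

lemma hasSum_poissonWeight (lam : ℝ) : HasSum (poissonWeight lam) 1 := by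
  have h := (NormedSpace.expSeries_div_hasSum_exp (lam / 2)).mul_left (exp (-lam / 2))
  rwa [← Real.exp_eq_exp_ℝ, ← Real.exp_add, show -lam / 2 + lam / 2 = 0 by ring, Real.exp_zero] at h

lemma succ_mul_poissonWeight (lam : ℝ) (k : ℕ) :
    ((k + 1 : ℕ) : ℝ) * poissonWeight lam (k + 1) = lam / 2 * poissonWeight lam k := by
  unfold poissonWeight
  rw [Nat.factorial_succ]
  push_cast
  field_simp
  ring

lemma min_one_mul_Gamma_le {b : ℝ} (hb : 0 < b) (k : ℕ) :
    min 1 b * Gamma b ≤ Gamma (b + k) := by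
  have hΓ := Gamma_pos_of_pos hb
  induction k with
  | zero => simpa using mul_le_of_le_one_left hΓ.le (min_le_left 1 b)
  | succ k ih =>
    have e : Gamma (b + (k + 1 : ℕ)) = (b + k) * Gamma (b + k) := by
      rw [← Gamma_add_one (by positivity)]; push_cast; ring_nf
    rw [e]
    rcases Nat.eq_zero_or_pos k with rfl | hk
    · simpa using mul_le_mul_of_nonneg_right (min_le_right 1 b) hΓ.le
    · have : (1 : ℝ) ≤ k := by exact_mod_cast hk
      have hp : 0 < Gamma (b + k) := Gamma_pos_of_pos (by positivity)
      nlinarith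

lemma poissonWeight_mul_gammaPDFReal {r lam x : ℝ} (hx : 0 < x) (k : ℕ) :
    poissonWeight lam k * gammaPDFReal (r / 2 + k) (1 / 2) x =
      exp (-lam / 2) * ((1 / 2) ^ (r / 2) * x ^ (r / 2 - 1) * exp (-x / 2)) *
        ((lam * x / 4) ^ k / (k.factorial : ℝ) / Gamma (r / 2 + k)) := by
  rw [gammaPDFReal_of_pos hx, poissonWeight, rpow_add (by norm_num), rpow_natCast,
    show r / 2 + k - 1 = (r / 2 - 1) + k by ring, rpow_add hx, rpow_natCast,
    show -(1 / 2 * x) = -x / 2 by ring,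
    show lam * x / 4 = lam / 2 * (1 / 2) * x by ring, mul_pow, mul_pow]
  ring

lemma summable_poissonWeight_mul_gammaPDFReal {r lam x : ℝ} (hr : 0 < r) (hl : 0 ≤ lam)
    (hx : 0 < x) :
    Summable fun k => poissonWeight lam k * gammaPDFReal (r / 2 + k) (1 / 2) x := by
  simp_rw [poissonWeight_mul_gammaPDFReal hx]
  refine Summable.mul_left _ ?_
  have hm : 0 < min 1 (r / 2) * Gamma (r / 2) :=
    mul_pos (lt_min one_pos (by linarith)) (Gamma_pos_of_pos (by linarith))
  refine Summable.of_nonneg_of_le (fun k => ?_) (fun k => ?_)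
    ((NormedSpace.expSeries_div_summable (lam * x / 4)).div_const (min 1 (r / 2) * Gamma (r / 2)))
  · have := Gamma_pos_of_pos (show 0 < r / 2 + (k : ℝ) by positivity)
    positivity
  · exact div_le_div_of_nonneg_left (by positivity) hm
      (min_one_mul_Gamma_le (by linarith) k)

/-- The noncentral chi-square density is a Poisson mixture of gamma densities. -/
lemma hasSum_ncChiSqPdf {r lam x : ℝ} (hr : 0 < r) (hl : 0 ≤ lam) (hx : 0 < x) :
    HasSum (fun k => poissonWeight lam k * gammaPDFReal (r / 2 + k) (1 / 2) x)
      (ncChiSqPdf r lam x) := by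
  convert (summable_poissonWeight_mul_gammaPDFReal hr hl hx).hasSum using 1
  rw [ncChiSqPdf, if_neg hx.not_ge]
  split_ifs with h0
  · subst h0
    rw [tsum_eq_single 0]
    · simp only [poissonWeight, gammaPDFReal_of_pos hx]
      simp only [neg_zero, zero_div, exp_zero, pow_zero, Nat.factorial_zero, Nat.cast_one,
        div_one, mul_one, Nat.cast_zero, add_zero, one_mul]
      rw [div_rpow one_pos.le two_pos.le, one_rpow, show -(1 / 2 * x) = -x / 2 by ring]
      field_simp
    · intro k hk
      simp [poissonWeight, hk]
  · have hl : 0 < lam := lt_of_le_of_ne hl (Ne.symm h0)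
    rw [besselI, ← tsum_mul_left]
    refine tsum_congr fun k => ?_
    rw [poissonWeight_mul_gammaPDFReal hx]
    have e1 : (√(lam * x) / 2) ^ (2 * (k : ℝ) + (r / 2 - 1)) =
        (lam * x / 4) ^ k * (lam ^ (r / 4 - 1 / 2) * x ^ (r / 4 - 1 / 2) *
          (2 * (1 / 2) ^ (r / 2))) := by
      rw [rpow_add (by positivity), rpow_mul (by positivity), rpow_natCast,
        show (√(lam * x) / 2) ^ (2 : ℝ) = lam * x / 4 by
          rw [rpow_two, div_pow, sq_sqrt (by positivity)]; norm_num,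
        div_rpow (by positivity) two_pos.le, sqrt_eq_rpow, ← rpow_mul (by positivity),
        mul_rpow hl.le hx.le, rpow_sub_one two_ne_zero, div_rpow one_pos.le two_pos.le, one_rpow]
      ring_nf
    have e2 : x ^ (r / 2 - 1) = x ^ (r / 4 - 1 / 2) * x ^ (r / 4 - 1 / 2) := by
      rw [← rpow_add hx]; ring_nf
    rw [e1, e2, div_rpow hx.le hl.le, show (k : ℝ) + (r / 2 - 1) + 1 = r / 2 + k by ring,
      show -(x + lam) / 2 = -lam / 2 + -x / 2 by ring, exp_add]
    have := Gamma_pos_of_pos (show 0 < r / 2 + (k : ℝ) by positivity)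
    have := rpow_pos_of_pos hl (r / 4 - 1 / 2)
    field_simp

lemma ncChiSq_eq_sum {r lam : ℝ} (hr : 0 < r) (hl : 0 ≤ lam) :
    ncChiSq r lam = Measure.sum fun k =>
      ENNReal.ofReal (poissonWeight lam k) • gammaMeasure (r / 2 + k) (1 / 2) := by
  have hm (k : ℕ) : Measurable (gammaPDF (r / 2 + k) (1 / 2)) :=
    (measurable_gammaPDFReal _ _).ennreal_ofReal
  simp_rw [gammaMeasure, ← withDensity_smul _ (hm _)]
  rw [← withDensity_tsum fun k => (hm k).const_smul _, ncChiSq]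
  refine withDensity_congr_ae ?_
  have h0 : ∀ᵐ x : ℝ, x ≠ 0 := by simp [ae_iff]
  filter_upwards [h0] with x hx0
  rw [tsum_apply (Pi.summable.2 fun _ => ENNReal.summable)]
  simp only [Pi.smul_apply, smul_eq_mul]
  rcases lt_or_gt_of_ne hx0 with hx | hx
  · simp [gammaPDF_of_neg hx, ncChiSqPdf, hx.le]
  · have h := hasSum_ncChiSqPdf hr hl hx
    have hk (k : ℕ) : 0 < r / 2 + (k : ℝ) := by positivity
    rw [← h.tsum_eq, ENNReal.ofReal_tsum_of_nonneg (fun k => mul_nonneg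
      (poissonWeight_nonneg hl k) (gammaPDFReal_nonneg (hk k) (by norm_num) x)) h.summable]
    exact tsum_congr fun k => ENNReal.ofReal_mul (poissonWeight_nonneg hl k)

lemma isProbabilityMeasure_ncChiSq {r lam : ℝ} (hr : 0 < r) (hl : 0 ≤ lam) :
    IsProbabilityMeasure (ncChiSq r lam) := by
  have (k : ℕ) : IsProbabilityMeasure (gammaMeasure (r / 2 + k) (1 / 2)) :=
    isProbabilityMeasure_gammaMeasure (by positivity) (by norm_num)
  refine ⟨?_⟩
  rw [ncChiSq_eq_sum hr hl, Measure.sum_apply _ MeasurableSet.univ]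
  simp only [Measure.smul_apply, measure_univ, smul_eq_mul, mul_one]
  rw [← ENNReal.ofReal_tsum_of_nonneg (poissonWeight_nonneg hl) (hasSum_poissonWeight lam).summable,
    (hasSum_poissonWeight lam).tsum_eq, ENNReal.ofReal_one]

lemma hasSum_integral_ncChiSq {r lam : ℝ} (hr : 0 < r) (hl : 0 ≤ lam) {f : ℝ → ℝ}
    (hf : Integrable f (ncChiSq r lam)) :
    HasSum (fun k => poissonWeight lam k * ∫ x, f x ∂gammaMeasure (r / 2 + k) (1 / 2))
      (∫ x, f x ∂ncChiSq r lam) := by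
  rw [ncChiSq_eq_sum hr hl] at hf ⊢
  have h := hasSum_integral_measure hf
  simpa only [integral_smul_measure, ENNReal.toReal_ofReal (poissonWeight_nonneg hl _),
    smul_eq_mul] using h

lemma integrable_id_ncChiSq {r lam : ℝ} (hr : 0 < r) (hl : 0 ≤ lam) :
    Integrable (fun x => x) (ncChiSq r lam) := by
  have hk (k : ℕ) : 0 < r / 2 + (k : ℝ) := by positivity
  rw [ncChiSq_eq_sum hr hl]
  refine integrable_sum_measure (fun k => (integrable_id_gammaMeasure (hk k)
    (by norm_num)).smul_measure ENNReal.ofReal_ne_top) ?_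
  simp only [integral_smul_measure, ENNReal.toReal_ofReal (poissonWeight_nonneg hl _),
    smul_eq_mul, integral_abs_gammaMeasure (hk _) (show (0 : ℝ) < 1 / 2 by norm_num)]
  have hs := (hasSum_poissonWeight lam).summable
  have h1 : Summable fun k : ℕ => (k : ℝ) * poissonWeight lam k := by
    rw [← summable_nat_add_iff 1]
    simp_rw [succ_mul_poissonWeight]
    exact hs.mul_left _
  refine ((hs.mul_left r).add (h1.mul_left 2)).congr fun k => ?_
  ring

/-- Second-order Stein identity for the noncentral chi-square distribution. -/
lemma ncChiSq_stein {r lam C : ℝ} (hr : 0 < r) (hl : 0 ≤ lam) {g g' g'' : ℝ → ℝ}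
    (hg : ∀ x, HasDerivAt g (g' x) x) (hg' : ∀ x, HasDerivAt g' (g'' x) x)
    (hc : Continuous g'') (hC : ∀ x, |g x| ≤ C) (hC' : ∀ x, |g' x| ≤ C)
    (hC'' : ∀ x, |g'' x| ≤ C) :
    ∫ x, (x * (g x - 4 * g' x + 4 * g'' x) - (r * (g x - 2 * g' x) + lam * g x))
      ∂ncChiSq r lam = 0 := by
  have := isProbabilityMeasure_ncChiSq hr hl
  have c1 : Continuous g' := continuous_iff_continuousAt.2 fun x => (hg' x).continuousAt
  have c0 : Continuous g := continuous_iff_continuousAt.2 fun x => (hg x).continuousAt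
  have hk (k : ℕ) : 0 < r / 2 + (k : ℝ) := by positivity
  have hh : (0 : ℝ) < 1 / 2 := by norm_num
  have i0 : Integrable g (ncChiSq r lam) := integrable_of_continuous_bounded c0 hC
  have i1 : Integrable g' (ncChiSq r lam) := integrable_of_continuous_bounded c1 hC'
  set q : ℝ → ℝ := fun x => g x - 2 * g' x with hq
  have iq : Integrable q (ncChiSq r lam) := i0.sub (i1.const_mul 2)
  have il : Integrable (fun x => x * (g x - 4 * g' x + 4 * g'' x)) (ncChiSq r lam) := by
    refine (integrable_id_ncChiSq hr hl).mul_bdd (c := C + 4 * C + 4 * C)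
      (by fun_prop) (.of_forall fun x => ?_)
    have a := abs_le.1 (hC x); have b := abs_le.1 (hC' x); have c := abs_le.1 (hC'' x)
    rw [norm_eq_abs, abs_le]; constructor <;> linarith
  have step1 (k : ℕ) : ∫ x, x * (g x - 4 * g' x + 4 * g'' x) ∂gammaMeasure (r / 2 + k) (1 / 2) =
      (r + 2 * k) * ∫ x, q x ∂gammaMeasure (r / 2 + k) (1 / 2) := by
    rw [integral_mul_gammaMeasure (hk k) hh, ← integral_gammaMeasure_add_one (hk k) hh
      (h := q) (h' := fun x => g' x - 2 * g'' x) (C := C + 2 * C) (C' := C + 2 * C)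
      (fun x => (hg x).sub ((hg' x).const_mul 2)) (by fun_prop)]
    · congr 1
      · ring
      · congr 1; ext x; simp only [hq]; ring
    · intro x
      have a := abs_le.1 (hC x); have b := abs_le.1 (hC' x)
      rw [abs_le]; constructor <;> simp only [hq] <;> linarith
    · intro x
      have a := abs_le.1 (hC'' x); have b := abs_le.1 (hC' x)
      rw [abs_le]; constructor <;> linarith
  have step2 (k : ℕ) : ∫ x, q x ∂gammaMeasure (r / 2 + (k + 1 : ℕ)) (1 / 2) =
      ∫ x, g x ∂gammaMeasure (r / 2 + k) (1 / 2) := by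
    rw [← integral_gammaMeasure_add_one (hk k) hh hg c1 hC hC']
    congr 1
    · push_cast; rw [add_assoc]
    · ext x; simp only [hq]; ring
  have S := hasSum_integral_ncChiSq hr hl il
  have Sq := (hasSum_integral_ncChiSq hr hl iq).mul_left r
  have S0 := (hasSum_integral_ncChiSq hr hl i0).mul_left lam
  have S2 : HasSum (fun k : ℕ => 2 * (k * poissonWeight lam k) *
      ∫ x, q x ∂gammaMeasure (r / 2 + k) (1 / 2)) (lam * ∫ x, g x ∂ncChiSq r lam) := by
    rw [← hasSum_nat_add_iff' 1]
    simp only [Finset.range_one, Finset.sum_singleton, Nat.cast_zero, zero_mul, mul_zero, sub_zero]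
    refine S0.congr_fun fun k => ?_
    rw [step2, succ_mul_poissonWeight]
    ring
  have ir : Integrable (fun x => r * (g x - 2 * g' x) + lam * g x) (ncChiSq r lam) :=
    (iq.const_mul r).add (i0.const_mul lam)
  rw [integral_sub il ir, sub_eq_zero,
    integral_add (iq.const_mul r) (i0.const_mul lam), integral_const_mul, integral_const_mul]
  refine S.unique ((Sq.add S2).congr_fun fun k => ?_)
  rw [step1]
  ring

/-- The Stein operator of the noncentral chi-square difference distribution. -/
def steinOp (r lam1 lam2 : ℝ) (f : ℝ → ℝ) (x : ℝ) : ℝ :=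
  16 * x * iteratedDeriv 4 f x + 16 * r * iteratedDeriv 3 f x
    - (8 * x + 4 * (lam1 - lam2)) * iteratedDeriv 2 f x
    - 4 * (lam1 + lam2 + r) * iteratedDeriv 1 f x + (x - (lam1 - lam2)) * f x

lemma continuous_steinOp (r lam1 lam2 : ℝ) {f : ℝ → ℝ} (hf : ContDiff ℝ 4 f) :
    Continuous (steinOp r lam1 lam2 f) := by
  have h0 := hf.continuous
  have h1 := hf.continuous_iteratedDeriv 1 (by norm_num)
  have h2 := hf.continuous_iteratedDeriv 2 (by norm_num)
  have h3 := hf.continuous_iteratedDeriv 3 (by norm_num)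
  have h4 := hf.continuous_iteratedDeriv 4 le_rfl
  unfold steinOp
  fun_prop

lemma isProbabilityMeasure_ncChiSqDiff {r lam1 lam2 : ℝ} (hr : 0 < r) (h1 : 0 ≤ lam1)
    (h2 : 0 ≤ lam2) : IsProbabilityMeasure (ncChiSqDiff r lam1 lam2) := by
  have := isProbabilityMeasure_ncChiSq hr h1
  have := isProbabilityMeasure_ncChiSq hr h2
  exact Measure.isProbabilityMeasure_map (by fun_prop)

lemma integrable_id_ncChiSqDiff {r lam1 lam2 : ℝ} (hr : 0 < r) (h1 : 0 ≤ lam1)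
    (h2 : 0 ≤ lam2) : Integrable (fun x => x) (ncChiSqDiff r lam1 lam2) := by
  have := isProbabilityMeasure_ncChiSq hr h1
  have := isProbabilityMeasure_ncChiSq hr h2
  rw [ncChiSqDiff, integrable_map_measure (by fun_prop) (by fun_prop)]
  exact ((integrable_id_ncChiSq hr h1).comp_fst _).sub ((integrable_id_ncChiSq hr h2).comp_snd _)

lemma hasDerivAt_iteratedDeriv {f : ℝ → ℝ} {n : ℕ} (hf : ContDiff ℝ n f) {j : ℕ} (hj : j < n)
    (x : ℝ) : HasDerivAt (iteratedDeriv j f) (iteratedDeriv (j + 1) f x) x := by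
  rw [iteratedDeriv_succ]
  exact (hf.differentiable_iteratedDeriv j (by exact_mod_cast hj) x).hasDerivAt

/-- The Stein identity for test functions with bounded derivatives. -/
lemma integral_steinOp_ncChiSqDiff_of_bounded {r lam1 lam2 C : ℝ} (hr : 0 < r) (h1 : 0 ≤ lam1)
    (h2 : 0 ≤ lam2) {f : ℝ → ℝ} (hf : ContDiff ℝ 4 f)
    (hC : ∀ j ≤ 4, ∀ x, |iteratedDeriv j f x| ≤ C) :
    ∫ x, steinOp r lam1 lam2 f x ∂ncChiSqDiff r lam1 lam2 = 0 := by
  have := isProbabilityMeasure_ncChiSq hr h1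
  have := isProbabilityMeasure_ncChiSq hr h2
  set F : ℕ → ℝ → ℝ := fun j => iteratedDeriv j f with hF
  have hd (j : ℕ) (hj : j < 4) (x : ℝ) : HasDerivAt (F j) (F (j + 1) x) x :=
    hasDerivAt_iteratedDeriv (n := 4) (by exact_mod_cast hf) hj x
  have hc (j : ℕ) (hj : j ≤ 4) : Continuous (F j) :=
    hf.continuous_iteratedDeriv j (by exact_mod_cast hj)
  have c0 := hc 0 (by norm_num)
  have c1 := hc 1 (by norm_num)
  have c2 := hc 2 (by norm_num)
  have c3 := hc 3 (by norm_num)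
  have c4 := hc 4 le_rfl
  have b (j : ℕ) (hj : j ≤ 4) (x : ℝ) : -C ≤ F j x ∧ F j x ≤ C := abs_le.1 (hC j hj x)
  have bound (σ : ℝ) (hσ : |σ| = 1) (j : ℕ) (hj : j + 2 ≤ 4) (x : ℝ) :
      |F j x + σ * 4 * F (j + 1) x + 4 * F (j + 2) x| ≤ 9 * C := by
    have a0 := b j (by omega) x
    have a1 := b (j + 1) (by omega) x
    have a2 := b (j + 2) hj x
    rw [abs_le]
    rcases eq_or_eq_neg_of_abs_eq hσ with rfl | rfl <;> constructor <;> linarith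
  have deriv_comb (σ : ℝ) (j : ℕ) (hj : j + 2 < 4) (x : ℝ) :
      HasDerivAt (fun x => F j x + σ * 4 * F (j + 1) x + 4 * F (j + 2) x)
        (F (j + 1) x + σ * 4 * F (j + 2) x + 4 * F (j + 3) x) x :=
    ((hd j (by omega) x).add ((hd (j + 1) (by omega) x).const_mul _)).add
      ((hd (j + 2) hj x).const_mul _)
  set B : ℝ → ℝ → ℝ → ℝ → ℝ := fun σ lam u t =>
    u * (F 0 t - 8 * F 2 t + 16 * F 4 t) -
      (r * (F 0 t + σ * 2 * F 1 t - 4 * F 2 t - σ * 8 * F 3 t) +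
        lam * (F 0 t + σ * 4 * F 1 t + 4 * F 2 t)) with hB
  have first (y : ℝ) : ∫ x, B 1 lam1 x (x - y) ∂ncChiSq r lam1 = 0 := by
    rw [← ncChiSq_stein hr h1 (C := 9 * C)
      (fun x => (deriv_comb 1 0 (by norm_num) (x - y)).comp_sub_const x y)
      (fun x => (deriv_comb 1 1 (by norm_num) (x - y)).comp_sub_const x y) (by fun_prop)
      (fun x => bound 1 (by simp) 0 (by norm_num) _)
      (fun x => bound 1 (by simp) 1 (by norm_num) _)
      (fun x => bound 1 (by simp) 2 (by norm_num) _)]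
    congr 1; ext x; simp only [hB]; ring
  have second (x : ℝ) : ∫ y, B (-1) lam2 y (x - y) ∂ncChiSq r lam2 = 0 := by
    rw [← ncChiSq_stein hr h2 (C := 9 * C)
      (g' := fun y => -(F 1 (x - y) + -1 * 4 * F 2 (x - y) + 4 * F 3 (x - y)))
      (g'' := fun y => -(-(F 2 (x - y) + -1 * 4 * F 3 (x - y) + 4 * F 4 (x - y))))
      (fun y => (deriv_comb (-1) 0 (by norm_num) (x - y)).comp_const_sub x y)
      (fun y => ((deriv_comb (-1) 1 (by norm_num) (x - y)).comp_const_sub x y).neg) (by fun_prop)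
      (fun y => bound (-1) (by simp) 0 (by norm_num) _)
      (fun y => by rw [abs_neg]; exact bound (-1) (by simp) 1 (by norm_num) _)
      (fun y => by rw [abs_neg, abs_neg]; exact bound (-1) (by simp) 2 (by norm_num) _)]
    congr 1; ext y; simp only [hB]; ring
  have intB (σ lam : ℝ) {u : ℝ × ℝ → ℝ}
      (hu : Integrable u ((ncChiSq r lam1).prod (ncChiSq r lam2))) :
      Integrable (fun p : ℝ × ℝ => B σ lam (u p) (p.1 - p.2))
        ((ncChiSq r lam1).prod (ncChiSq r lam2)) := by
    have iF (j : ℕ) (hj : j ≤ 4) : Integrable (fun p : ℝ × ℝ => F j (p.1 - p.2))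
        ((ncChiSq r lam1).prod (ncChiSq r lam2)) :=
      .of_bound ((hc j hj).comp (by fun_prop)).aestronglyMeasurable C
        (.of_forall fun p => hC j hj _)
    have uF (j : ℕ) (hj : j ≤ 4) : Integrable (fun p : ℝ × ℝ => u p * F j (p.1 - p.2))
        ((ncChiSq r lam1).prod (ncChiSq r lam2)) :=
      hu.mul_bdd ((hc j hj).comp (by fun_prop)).aestronglyMeasurable
        (.of_forall fun p => hC j hj _)
    have i0 := iF 0 (by norm_num)
    have i1 := iF 1 (by norm_num)
    have i2 := iF 2 (by norm_num)
    have i3 := iF 3 (by norm_num)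
    refine (((uF 0 (by norm_num)).sub ((uF 2 (by norm_num)).const_mul 8)).add
      ((uF 4 le_rfl).const_mul 16)).sub
      ((((i0.add (i1.const_mul (σ * 2))).sub (i2.const_mul 4)).sub (i3.const_mul (σ * 8))
        |>.const_mul r).add
        (((i0.add (i1.const_mul (σ * 4))).add (i2.const_mul 4)).const_mul lam)) |>.congr
      (.of_forall fun p => ?_)
    simp only [hB, Pi.add_apply, Pi.sub_apply]
    ring
  have int1 := intB 1 lam1 ((integrable_id_ncChiSq hr h1).comp_fst _)
  have int2 := intB (-1) lam2 ((integrable_id_ncChiSq hr h2).comp_snd _)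
  rw [ncChiSqDiff, integral_map (by fun_prop)
    (continuous_steinOp r lam1 lam2 hf).aestronglyMeasurable]
  have split (p : ℝ × ℝ) : steinOp r lam1 lam2 f (p.1 - p.2) =
      B 1 lam1 p.1 (p.1 - p.2) - B (-1) lam2 p.2 (p.1 - p.2) := by
    simp only [steinOp, hB, hF, iteratedDeriv_zero]
    ring
  simp_rw [split]
  rw [integral_sub int1 int2, integral_prod_symm _ int1, integral_prod _ int2]
  simp [first, second]

lemma HasCompactSupport.iteratedDeriv_real {f : ℝ → ℝ} (hf : HasCompactSupport f) (j : ℕ) :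
    HasCompactSupport (iteratedDeriv j f) := by
  induction j with
  | zero => simpa using hf
  | succ j ih => rw [iteratedDeriv_succ]; exact ih.deriv

lemma exists_bound_iteratedDeriv {f : ℝ → ℝ} {n : ℕ} (hf : ContDiff ℝ n f)
    (hs : HasCompactSupport f) : ∃ C, ∀ j ≤ n, ∀ x, |iteratedDeriv j f x| ≤ C := by
  have h (j : ℕ) : ∃ C, j ≤ n → ∀ x, |iteratedDeriv j f x| ≤ C := by
    by_cases hj : j ≤ n
    · obtain ⟨C, hC⟩ := (hs.iteratedDeriv_real j).exists_bound_of_continuous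
        (hf.continuous_iteratedDeriv j (by exact_mod_cast hj))
      exact ⟨C, fun _ => hC⟩
    · exact ⟨0, fun h => absurd h hj⟩
  choose C hC using h
  refine ⟨∑ j ∈ Finset.range (n + 1), |C j|, fun j hj x => (hC j hj x).trans ?_⟩
  exact (le_abs_self _).trans (Finset.single_le_sum (f := fun j => |C j|)
    (fun i _ => abs_nonneg _) (Finset.mem_range.2 (by omega)))

/-- If the Stein identity holds for compactly supported test functions, then it holds for all
test functions satisfying the integrability conditions. -/
lemma integral_steinOp_eq_zero_of_hasCompactSupport {μ : Measure ℝ} {r lam1 lam2 : ℝ}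
    (H : ∀ f : ℝ → ℝ, ContDiff ℝ 4 f → HasCompactSupport f →
      ∫ x, steinOp r lam1 lam2 f x ∂μ = 0)
    {f : ℝ → ℝ} (hf : ContDiff ℝ 4 f)
    (hi : ∀ j : ℕ, j ≤ 3 → Integrable (iteratedDeriv j f) μ)
    (hxi : ∀ j : ℕ, j ≤ 4 → Integrable (fun x => x * iteratedDeriv j f x) μ) :
    ∫ x, steinOp r lam1 lam2 f x ∂μ = 0 := by
  let χ : ContDiffBump (0 : ℝ) := ⟨1, 2, one_pos, one_lt_two⟩
  have hχ : ContDiff ℝ 4 χ := χ.contDiff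
  obtain ⟨K, hK⟩ := exists_bound_iteratedDeriv (n := 4) (by exact_mod_cast hχ) χ.hasCompactSupport
  set ε : ℕ → ℝ := fun n => 1 / ((n : ℝ) + 1) with hε
  have ε_pos (n : ℕ) : 0 < ε n := Nat.one_div_pos_of_nat
  have ε_le (n : ℕ) : ε n ≤ 1 := by
    rw [hε]; exact (div_le_one (by positivity)).2 (by simp)
  have ε_tendsto : Tendsto ε atTop (𝓝 0) := tendsto_one_div_add_atTop_nhds_zero_nat
  set c : ℕ → ℕ → ℝ → ℝ := fun n k x => ε n ^ k * iteratedDeriv k χ (ε n * x) with hc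
  have c_bound (n k : ℕ) (hk : k ≤ 4) (x : ℝ) : |c n k x| ≤ K := by
    rw [hc, abs_mul, abs_of_nonneg (by have := ε_pos n; positivity)]
    exact (mul_le_of_le_one_left (abs_nonneg _) (pow_le_one₀ (ε_pos n).le (ε_le n))).trans
      (hK k hk _)
  have c_cont (n k : ℕ) (hk : k ≤ 4) : Continuous (c n k) := by
    have := hχ.continuous_iteratedDeriv k (by exact_mod_cast hk)
    fun_prop
  have arg_tendsto (k : ℕ) (hk : k ≤ 4) (x : ℝ) :
      Tendsto (fun n => iteratedDeriv k χ (ε n * x)) atTop (𝓝 (iteratedDeriv k χ 0)) := by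
    have h1 := (hχ.continuous_iteratedDeriv k (by exact_mod_cast hk)).tendsto 0
    have h2 := ε_tendsto.mul_const x
    rw [zero_mul] at h2
    exact h1.comp h2
  have c_tendsto (k : ℕ) (hk : k ≤ 4) (x : ℝ) :
      Tendsto (fun n => c n k x) atTop (𝓝 (if k = 0 then 1 else 0)) := by
    have h := (ε_tendsto.pow k).mul (arg_tendsto k hk x)
    convert h using 2
    split_ifs with h0
    · subst h0
      simpa using (χ.one_of_mem_closedBall (by simp [χ])).symm
    · simp [h0]
  have limit (k : ℕ) (hk : k ≤ 4) {h : ℝ → ℝ} (hh : Integrable h μ) :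
      Tendsto (fun n => ∫ x, c n k x * h x ∂μ) atTop
        (𝓝 (∫ x, (if k = 0 then 1 else 0) * h x ∂μ)) := by
    refine tendsto_integral_of_dominated_convergence (fun x => K * |h x|)
      (fun n => (c_cont n k hk).aestronglyMeasurable.mul hh.aestronglyMeasurable)
      (hh.abs.const_mul K) (fun n => .of_forall fun x => ?_)
      (.of_forall fun x => (c_tendsto k hk x).mul_const _)
    rw [norm_eq_abs, abs_mul]
    exact mul_le_mul_of_nonneg_right (c_bound n k hk x) (abs_nonneg _)
  have int_mul (n k : ℕ) (hk : k ≤ 4) {h : ℝ → ℝ} (hh : Integrable h μ) :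
      Integrable (fun x => c n k x * h x) μ :=
    hh.bdd_mul (c_cont n k hk).aestronglyMeasurable (.of_forall fun x => c_bound n k hk x)
  set F : ℕ → ℝ → ℝ := fun j => iteratedDeriv j f with hF
  set H0 : ℝ → ℝ := steinOp r lam1 lam2 f with hH0
  set H1 : ℝ → ℝ := fun x => 64 * (x * F 3 x) + 48 * r * F 2 x - 16 * (x * F 1 x)
    - 8 * (lam1 - lam2) * F 1 x - 4 * (lam1 + lam2 + r) * F 0 x with hH1
  set H2 : ℝ → ℝ := fun x => 96 * (x * F 2 x) + 48 * r * F 1 x - 8 * (x * F 0 x)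
    - 4 * (lam1 - lam2) * F 0 x with hH2
  set H3 : ℝ → ℝ := fun x => 64 * (x * F 1 x) + 16 * r * F 0 x with hH3
  set H4 : ℝ → ℝ := fun x => 16 * (x * F 0 x) with hH4
  have f0 := hi 0 (by norm_num)
  have f1 := hi 1 (by norm_num)
  have f2 := hi 2 (by norm_num)
  have f3 := hi 3 le_rfl
  have x0 := hxi 0 (by norm_num)
  have x1 := hxi 1 (by norm_num)
  have x2 := hxi 2 (by norm_num)
  have x3 := hxi 3 (by norm_num)
  have x4 := hxi 4 le_rfl
  have int0 : Integrable H0 μ := by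
    refine ((((((x4.const_mul 16).add (f3.const_mul (16 * r))).sub (x2.const_mul 8)).sub
      (f2.const_mul (4 * (lam1 - lam2)))).sub (f1.const_mul (4 * (lam1 + lam2 + r)))).add
      x0).sub (f0.const_mul (lam1 - lam2)) |>.congr (.of_forall fun x => ?_)
    simp only [hH0, steinOp, Pi.add_apply, Pi.sub_apply, iteratedDeriv_zero]
    ring
  have int1 : Integrable H1 μ :=
    ((((x3.const_mul 64).add (f2.const_mul (48 * r))).sub (x1.const_mul 16)).sub
      (f1.const_mul (8 * (lam1 - lam2)))).sub (f0.const_mul (4 * (lam1 + lam2 + r)))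
  have int2 : Integrable H2 μ :=
    (((x2.const_mul 96).add (f1.const_mul (48 * r))).sub (x0.const_mul 8)).sub
      (f0.const_mul (4 * (lam1 - lam2)))
  have int3 : Integrable H3 μ := (x1.const_mul 64).add (f0.const_mul (16 * r))
  have int4 : Integrable H4 μ := x0.const_mul 16
  have zero (n : ℕ) : (∫ x, c n 0 x * H0 x ∂μ) + (∫ x, c n 1 x * H1 x ∂μ)
      + (∫ x, c n 2 x * H2 x ∂μ) + (∫ x, c n 3 x * H3 x ∂μ) + (∫ x, c n 4 x * H4 x ∂μ) = 0 := by
    have i0 := int_mul n 0 (by norm_num) int0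
    have i1 := int_mul n 1 (by norm_num) int1
    have i2 := int_mul n 2 (by norm_num) int2
    have i3 := int_mul n 3 (by norm_num) int3
    have i4 := int_mul n 4 le_rfl int4
    set χn : ℝ → ℝ := fun x => χ (ε n * x) with hχn
    have hχn' : ContDiff ℝ 4 χn := hχ.comp (contDiff_const.mul contDiff_id)
    have hχs : HasCompactSupport χn :=
      χ.hasCompactSupport.comp_homeomorph (Homeomorph.mulLeft₀ (ε n) (ε_pos n).ne')
    have hcn (k : ℕ) (hk : k ≤ 4) : iteratedDeriv k χn = c n k :=
      iteratedDeriv_comp_const_mul (hχ.of_le (by exact_mod_cast hk)) (ε n)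
    have prod (k : ℕ) (hk : k ≤ 4) (x : ℝ) := iteratedDeriv_mul (n := k)
      (hf.of_le (by exact_mod_cast hk)).contDiffAt (hχn'.of_le (by exact_mod_cast hk)).contDiffAt
      (x := x)
    have s1 : Integrable (fun x => c n 0 x * H0 x + c n 1 x * H1 x) μ := i0.add i1
    have s2 : Integrable (fun x => c n 0 x * H0 x + c n 1 x * H1 x + c n 2 x * H2 x) μ :=
      s1.add i2
    have s3 : Integrable
        (fun x => c n 0 x * H0 x + c n 1 x * H1 x + c n 2 x * H2 x + c n 3 x * H3 x) μ :=
      s2.add i3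
    rw [← H (f * χn) (hf.mul hχn') hχs.mul_left, ← integral_add i0 i1, ← integral_add s1 i2,
      ← integral_add s2 i3, ← integral_add s3 i4]
    refine integral_congr_ae (.of_forall fun x => ?_)
    have e0 : χn x = c n 0 x := by rw [← hcn 0 (by norm_num), iteratedDeriv_zero]
    have d2 : Nat.choose 4 2 = 6 := rfl
    have d3 : Nat.choose 4 3 = 4 := rfl
    have d4 : Nat.choose 3 2 = 3 := rfl
    simp only [steinOp, prod 1 (by norm_num), prod 2 (by norm_num), prod 3 (by norm_num),
      prod 4 le_rfl, Finset.sum_range_succ, Finset.range_zero, Finset.sum_empty, Nat.reduceSub,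
      hcn 0 (by norm_num), hcn 1 (by norm_num), hcn 2 (by norm_num), hcn 3 (by norm_num),
      hcn 4 le_rfl, Nat.choose_zero_right, Nat.choose_one_right, Nat.choose_self, d2, d3, d4,
      Pi.mul_apply, e0, hH0, hH1, hH2, hH3, hH4, hF, iteratedDeriv_zero]
    push_cast
    ring
  have lim := ((((limit 0 (by norm_num) int0).add (limit 1 (by norm_num) int1)).add
    (limit 2 (by norm_num) int2)).add (limit 3 (by norm_num) int3)).add (limit 4 le_rfl int4)
  simp only [zero] at lim
  simpa using (tendsto_nhds_unique lim tendsto_const_nhds)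

/-- A real trigonometric polynomial of frequency `t`. -/
def trig (t a b x : ℝ) : ℝ := a * cos (t * x) + b * sin (t * x)

lemma deriv_trig (t a b : ℝ) : deriv (trig t a b) = trig t (t * b) (-(t * a)) := by
  ext x
  have ht : HasDerivAt (fun x => t * x) (t * 1) x := (hasDerivAt_id x).const_mul t
  have h : HasDerivAt (trig t a b) _ x := (ht.cos.const_mul a).add (ht.sin.const_mul b)
  rw [h.deriv, trig]
  ring

lemma contDiff_trig (t a b : ℝ) {n : WithTop ℕ∞} : ContDiff ℝ n (trig t a b) := by
  unfold trig
  exact (contDiff_const.mul (contDiff_cos.comp (contDiff_const.mul contDiff_id))).add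
    (contDiff_const.mul (contDiff_sin.comp (contDiff_const.mul contDiff_id)))

lemma exists_iteratedDeriv_trig (t a b : ℝ) (j : ℕ) :
    ∃ a' b', iteratedDeriv j (trig t a b) = trig t a' b' := by
  induction j with
  | zero => exact ⟨a, b, iteratedDeriv_zero⟩
  | succ j ih =>
    obtain ⟨a', b', h⟩ := ih
    exact ⟨_, _, by rw [iteratedDeriv_succ, h, deriv_trig]⟩

lemma abs_trig_le (t a b x : ℝ) : |trig t a b x| ≤ |a| + |b| := by
  unfold trig
  refine (abs_add_le _ _).trans (add_le_add ?_ ?_) <;> rw [abs_mul]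
  · exact mul_le_of_le_one_right (abs_nonneg _) (abs_cos_le_one _)
  · exact mul_le_of_le_one_right (abs_nonneg _) (abs_sin_le_one _)

lemma integrable_trig {μ : Measure ℝ} [IsFiniteMeasure μ] (t a b : ℝ) :
    Integrable (trig t a b) μ :=
  integrable_of_continuous_bounded (contDiff_trig t a b (n := 0)).continuous (abs_trig_le t a b)

lemma integrable_mul_trig {μ : Measure ℝ} (hμ : Integrable (fun x => x) μ) (t a b : ℝ) :
    Integrable (fun x => x * trig t a b x) μ :=
  hμ.mul_bdd (contDiff_trig t a b (n := 0)).continuous.aestronglyMeasurable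
    (.of_forall (abs_trig_le t a b))

lemma steinOp_trig (r lam1 lam2 t a b x : ℝ) :
    steinOp r lam1 lam2 (trig t a b) x = (1 + 4 * t ^ 2) ^ 2 * (x * trig t a b x)
      + trig t (-(16 * r * t ^ 3 * b) + 4 * (lam1 - lam2) * t ^ 2 * a
          - 4 * (lam1 + lam2 + r) * t * b - (lam1 - lam2) * a)
        (16 * r * t ^ 3 * a + 4 * (lam1 - lam2) * t ^ 2 * b
          + 4 * (lam1 + lam2 + r) * t * a - (lam1 - lam2) * b) x := by
  have e1 : iteratedDeriv 1 (trig t a b) = trig t (t * b) (-(t * a)) := by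
    rw [iteratedDeriv_one, deriv_trig]
  have e2 : iteratedDeriv 2 (trig t a b) = trig t (-(t ^ 2 * a)) (-(t ^ 2 * b)) := by
    rw [iteratedDeriv_succ, e1, deriv_trig]; ring_nf
  have e3 : iteratedDeriv 3 (trig t a b) = trig t (-(t ^ 3 * b)) (t ^ 3 * a) := by
    rw [iteratedDeriv_succ, e2, deriv_trig]; ring_nf
  have e4 : iteratedDeriv 4 (trig t a b) = trig t (t ^ 4 * a) (t ^ 4 * b) := by
    rw [iteratedDeriv_succ, e3, deriv_trig]; ring_nf
  simp only [steinOp, e1, e2, e3, e4, trig]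
  ring

/-- The logarithmic derivative of the characteristic function of a noncentral chi-square
difference. -/
def charFunCoeff (r lam1 lam2 t : ℝ) : ℂ :=
  (-(16 * r * t ^ 3) - 4 * (lam1 + lam2 + r) * t
    + (lam1 - lam2) * (1 - 4 * t ^ 2) * Complex.I) / (1 + 4 * t ^ 2) ^ 2

lemma norm_charFunCoeff_le {r lam1 lam2 : ℝ} (hr : 0 < r) (h1 : 0 ≤ lam1) (h2 : 0 ≤ lam2)
    (t : ℝ) : ‖charFunCoeff r lam1 lam2 t‖ ≤ 4 * r + 3 * (lam1 + lam2) := by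
  have hs : 0 < 1 + 4 * t ^ 2 := by positivity
  have e : charFunCoeff r lam1 lam2 t =
      (((-(16 * r * t ^ 3) - 4 * (lam1 + lam2 + r) * t) / (1 + 4 * t ^ 2) ^ 2 : ℝ) : ℂ)
        + (((lam1 - lam2) * (1 - 4 * t ^ 2) / (1 + 4 * t ^ 2) ^ 2 : ℝ) : ℂ) * Complex.I := by
    simp only [charFunCoeff]; push_cast; ring
  have ht : 2 * |t| ≤ 1 + 4 * |t| ^ 2 := by nlinarith [sq_nonneg (2 * |t| - 1)]
  have hs1 : 1 ≤ 1 + 4 * t ^ 2 := by nlinarith [sq_nonneg t]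
  have hΔ : |lam1 - lam2| ≤ lam1 + lam2 := abs_le.2 ⟨by linarith, by linarith⟩
  have hsq : |t| ^ 2 = t ^ 2 := sq_abs t
  rw [e]
  refine (norm_add_le _ _).trans ?_
  rw [norm_mul, Complex.norm_I, mul_one, Complex.norm_real, Complex.norm_real, norm_eq_abs,
    norm_eq_abs, abs_div, abs_div, abs_of_pos (pow_pos hs 2), ← add_div, div_le_iff₀ (by positivity)]
  have a1 : |-(16 * r * t ^ 3) - 4 * (lam1 + lam2 + r) * t| ≤
      (4 * r + 2 * (lam1 + lam2)) * (1 + 4 * t ^ 2) ^ 2 := by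
    have : -(16 * r * t ^ 3) - 4 * (lam1 + lam2 + r) * t =
        -(4 * r * (1 + 4 * t ^ 2) * t + 4 * (lam1 + lam2) * t) := by ring
    rw [this, abs_neg]
    refine (abs_add_le _ _).trans ?_
    rw [abs_mul _ t, abs_mul _ t, abs_of_nonneg (by positivity : 0 ≤ 4 * r * (1 + 4 * t ^ 2)),
      abs_of_nonneg (by positivity : 0 ≤ 4 * (lam1 + lam2))]
    rw [hsq] at ht
    have p1 : 4 * r * (1 + 4 * t ^ 2) * |t| ≤ 4 * r * (1 + 4 * t ^ 2) * (1 + 4 * t ^ 2) :=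
      mul_le_mul_of_nonneg_left (by linarith [abs_nonneg t]) (by positivity)
    have p2 : 4 * (lam1 + lam2) * |t| ≤ 2 * (lam1 + lam2) * (1 + 4 * t ^ 2) := by
      nlinarith
    have p3 : 2 * (lam1 + lam2) * (1 + 4 * t ^ 2) ≤
        2 * (lam1 + lam2) * (1 + 4 * t ^ 2) * (1 + 4 * t ^ 2) :=
      le_mul_of_one_le_right (by positivity) hs1
    nlinarith
  have a2 : |(lam1 - lam2) * (1 - 4 * t ^ 2)| ≤ (lam1 + lam2) * (1 + 4 * t ^ 2) ^ 2 := by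
    rw [abs_mul]
    refine mul_le_mul hΔ ?_ (abs_nonneg _) (by positivity)
    rw [abs_le]
    constructor <;> nlinarith [sq_nonneg t]
  linarith

lemma hasDerivAt_charFun_of_integrable {μ : Measure ℝ} [IsFiniteMeasure μ]
    (hμ : Integrable (fun x => x) μ) (t : ℝ) :
    HasDerivAt (charFun μ) (∫ x : ℝ, Complex.exp (t * x * Complex.I) * (x * Complex.I) ∂μ) t := by
  have h := hasDerivAt_integral_of_dominated_loc_of_deriv_le (μ := μ) (𝕜 := ℝ)
    (F := fun t x : ℝ => Complex.exp (t * x * Complex.I))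
    (F' := fun t x : ℝ => Complex.exp (t * x * Complex.I) * (x * Complex.I)) (s := univ)
    (x₀ := t) (bound := fun x => |x|) univ_mem
    (.of_forall fun t => (by fun_prop : Continuous _).aestronglyMeasurable)
    (.of_bound (by fun_prop : Continuous _).aestronglyMeasurable 1 (.of_forall fun x => ?_))
    (by fun_prop : Continuous _).aestronglyMeasurable
    (.of_forall fun x s _ => ?_) hμ.abs (.of_forall fun x s _ => ?_)
  · rw [show charFun μ = _ from funext charFun_apply_real]
    exact h.2
  · rw [← Complex.ofReal_mul, Complex.norm_exp_ofReal_mul_I]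
  · rw [norm_mul, ← Complex.ofReal_mul, Complex.norm_exp_ofReal_mul_I]
    simp
  · have h1 : HasDerivAt (fun s : ℝ => (s : ℂ) * (x * Complex.I)) (1 * (x * Complex.I)) s :=
      Complex.ofRealCLM.hasDerivAt.mul_const _
    simpa [mul_assoc] using h1.cexp

lemma integral_trig_eq {μ : Measure ℝ} [IsFiniteMeasure μ] (t : ℝ) :
    charFun μ t = ((∫ x, trig t 1 0 x ∂μ : ℝ) : ℂ) + (∫ x, trig t 0 1 x ∂μ : ℝ) * Complex.I := by
  rw [charFun_apply_real, ← integral_complex_ofReal, ← integral_complex_ofReal,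
    ← integral_mul_const, ← integral_add (integrable_trig t 1 0).ofReal
      ((integrable_trig t 0 1).ofReal.mul_const _)]
  congr 1
  ext x
  rw [Complex.exp_mul_I]
  simp [trig]

lemma integral_mul_trig_eq {μ : Measure ℝ} (hμ : Integrable (fun x => x) μ) (t : ℝ) :
    ∫ x : ℝ, Complex.exp (t * x * Complex.I) * (x * Complex.I) ∂μ =
      (((∫ x, x * trig t 1 0 x ∂μ : ℝ) : ℂ)
        + (∫ x, x * trig t 0 1 x ∂μ : ℝ) * Complex.I) * Complex.I := by
  rw [← integral_complex_ofReal, ← integral_complex_ofReal,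
    ← integral_mul_const, ← integral_add (integrable_mul_trig hμ t 1 0).ofReal
      ((integrable_mul_trig hμ t 0 1).ofReal.mul_const _), ← integral_mul_const]
  congr 1
  ext x
  rw [Complex.exp_mul_I]
  simp [trig]
  ring

lemma integral_trig {μ : Measure ℝ} [IsFiniteMeasure μ] (t a b : ℝ) :
    ∫ x, trig t a b x ∂μ = a * ∫ x, trig t 1 0 x ∂μ + b * ∫ x, trig t 0 1 x ∂μ := by
  rw [← integral_const_mul, ← integral_const_mul,
    ← integral_add ((integrable_trig t 1 0).const_mul a) ((integrable_trig t 0 1).const_mul b)]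
  simp [trig]

/-- The Stein identity for trigonometric functions is a linear differential equation for the
characteristic function. -/
lemma hasDerivAt_charFun_of_steinOp {μ : Measure ℝ} [IsFiniteMeasure μ] {r lam1 lam2 : ℝ}
    (hμ : Integrable (fun x => x) μ)
    (H : ∀ t a b, ∫ x, steinOp r lam1 lam2 (trig t a b) x ∂μ = 0) (t : ℝ) :
    HasDerivAt (charFun μ) (charFunCoeff r lam1 lam2 t * charFun μ t) t := by
  refine (hasDerivAt_charFun_of_integrable hμ t).congr_deriv ?_
  have hc := H t 1 0
  have hs := H t 0 1
  simp_rw [steinOp_trig] at hc hs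
  rw [integral_add ((integrable_mul_trig hμ t _ _).const_mul _) (integrable_trig t _ _),
    integral_const_mul, integral_trig] at hc hs
  rw [integral_mul_trig_eq hμ, integral_trig_eq, charFunCoeff]
  set u := ∫ x, trig t 1 0 x ∂μ
  set v := ∫ x, trig t 0 1 x ∂μ
  set p := ∫ x, x * trig t 1 0 x ∂μ
  set q := ∫ x, x * trig t 0 1 x ∂μ
  have hne : (1 + 4 * (t : ℂ) ^ 2) ^ 2 ≠ 0 := by
    have : 0 < 1 + 4 * t ^ 2 := by positivity
    exact pow_ne_zero 2 (by exact_mod_cast this.ne')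
  have hc' := congrArg (fun x : ℝ => (x : ℂ)) hc
  have hs' := congrArg (fun x : ℝ => (x : ℂ)) hs
  push_cast at hc' hs'
  rw [div_mul_eq_mul_div, eq_div_iff hne]
  linear_combination Complex.I * hc' - hs' +
    ((1 + 4 * (t : ℂ) ^ 2) ^ 2 * q + v * (lam1 - lam2) * (4 * t ^ 2 - 1)) * Complex.I_sq

/-- A law with finite mean is determined by the Stein identity for trigonometric functions. -/
lemma eq_of_integral_steinOp_trig {μ ν : Measure ℝ} [IsProbabilityMeasure μ]
    [IsProbabilityMeasure ν] {r lam1 lam2 : ℝ} (hr : 0 < r) (h1 : 0 ≤ lam1) (h2 : 0 ≤ lam2)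
    (hμ : Integrable (fun x => x) μ) (hν : Integrable (fun x => x) ν)
    (Hμ : ∀ t a b, ∫ x, steinOp r lam1 lam2 (trig t a b) x ∂μ = 0)
    (Hν : ∀ t a b, ∫ x, steinOp r lam1 lam2 (trig t a b) x ∂ν = 0) : μ = ν := by
  refine Measure.ext_of_charFun (ODE_solution_unique_univ
    (v := fun t z => charFunCoeff r lam1 lam2 t * z) (s := fun _ => univ)
    (K := (4 * r + 3 * (lam1 + lam2)).toNNReal) (t₀ := 0) (fun t => ?_)
    (fun t => ⟨hasDerivAt_charFun_of_steinOp hμ Hμ t, mem_univ _⟩)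
    (fun t => ⟨hasDerivAt_charFun_of_steinOp hν Hν t, mem_univ _⟩) (by simp))
  refine LipschitzOnWith.of_dist_le_mul fun x _ y _ => ?_
  rw [dist_eq_norm, dist_eq_norm, ← mul_sub, norm_mul, Real.coe_toNNReal _ (by positivity)]
  exact mul_le_mul_of_nonneg_right (norm_charFunCoeff_le hr h1 h2 t) (norm_nonneg _)

/-- The Stein identity for the noncentral chi-square difference distribution. -/
lemma integral_steinOp_ncChiSqDiff {r lam1 lam2 : ℝ} (hr : 0 < r) (h1 : 0 ≤ lam1)
    (h2 : 0 ≤ lam2) {f : ℝ → ℝ} (hf : ContDiff ℝ 4 f)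
    (hi : ∀ j : ℕ, j ≤ 3 → Integrable (iteratedDeriv j f) (ncChiSqDiff r lam1 lam2))
    (hxi : ∀ j : ℕ, j ≤ 4 →
      Integrable (fun x => x * iteratedDeriv j f x) (ncChiSqDiff r lam1 lam2)) :
    ∫ x, steinOp r lam1 lam2 f x ∂ncChiSqDiff r lam1 lam2 = 0 := by
  refine integral_steinOp_eq_zero_of_hasCompactSupport (fun g hg hs => ?_) hf hi hxi
  obtain ⟨C, hC⟩ := exists_bound_iteratedDeriv (n := 4) (by exact_mod_cast hg) hs
  exact integral_steinOp_ncChiSqDiff_of_bounded hr h1 h2 hg hC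

/-- Stein characterisation of the noncentral chi-square difference
distribution. Let `T = V₁ - V₂` with `V₁ ~ χ'²_r(λ₁)` and `V₂ ~ χ'²_r(λ₂)` independent,
`r > 0`, `λ₁, λ₂ ≥ 0`, and let `W` be a real-valued random variable with `E|W| < ∞`.
With `A₁ f (x) = 16x f⁗(x) + 16r f‴(x) - (8x + 4(λ₁-λ₂)) f″(x) - 4(λ₁+λ₂+r) f′(x)
+ (x - (λ₁-λ₂)) f(x)`, we have `W =_d T` iff `E[A₁ f (W)] = 0` for all `f ∈ F₄(W)`. -/
theorem ncChiSqDiff_stein_characterisation {Ω : Type*} [MeasurableSpace Ω]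
    (P : Measure Ω) [IsProbabilityMeasure P] (r lam1 lam2 : ℝ) (hr : 0 < r)
    (h1 : 0 ≤ lam1) (h2 : 0 ≤ lam2) (W : Ω → ℝ) (hW : Measurable W)
    (hWint : Integrable W P) :
    Measure.map W P = ncChiSqDiff r lam1 lam2 ↔
      ∀ f : ℝ → ℝ, ContDiff ℝ 4 f →
        (∀ j : ℕ, j ≤ 3 → Integrable (fun ω => iteratedDeriv j f (W ω)) P) →
        (∀ j : ℕ, j ≤ 4 → Integrable (fun ω => W ω * iteratedDeriv j f (W ω)) P) →
        ∫ ω, (16 * W ω * iteratedDeriv 4 f (W ω) + 16 * r * iteratedDeriv 3 f (W ω)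
            - (8 * W ω + 4 * (lam1 - lam2)) * iteratedDeriv 2 f (W ω)
            - 4 * (lam1 + lam2 + r) * iteratedDeriv 1 f (W ω)
            + (W ω - (lam1 - lam2)) * f (W ω)) ∂P = 0 := by
  have hm := hW.aemeasurable (μ := P)
  have := isProbabilityMeasure_ncChiSqDiff hr h1 h2
  have : IsProbabilityMeasure (Measure.map W P) := Measure.isProbabilityMeasure_map hm
  constructor
  · intro h f hf hi hxi
    have hc (j : ℕ) (hj : j ≤ 4) : Continuous (iteratedDeriv j f) :=
      hf.continuous_iteratedDeriv j (by exact_mod_cast hj)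
    have key := integral_steinOp_ncChiSqDiff hr h1 h2 hf
      (fun j hj => by
        rw [← h, integrable_map_measure (hc j (by omega)).aestronglyMeasurable hm]
        exact hi j hj)
      (fun j hj => by
        rw [← h]
        exact (integrable_map_measure (continuous_id'.mul (hc j hj)).aestronglyMeasurable
          hm).2 (hxi j hj))
    rwa [← h, integral_map hm (continuous_steinOp r lam1 lam2 hf).aestronglyMeasurable] at key
  · intro H
    have hT := integrable_id_ncChiSqDiff hr h1 h2
    have hWmap : Integrable (fun x => x) (Measure.map W P) :=
      (integrable_map_measure (by fun_prop) hm).2 hWint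
    refine eq_of_integral_steinOp_trig hr h1 h2 hWmap hT (fun t a b => ?_) (fun t a b => ?_)
    · rw [integral_map hm
        (continuous_steinOp r lam1 lam2 (contDiff_trig t a b)).aestronglyMeasurable]
      refine H (trig t a b) (contDiff_trig t a b) (fun j _ => ?_) (fun j _ => ?_) <;>
        obtain ⟨a', b', hj⟩ := exists_iteratedDeriv_trig t a b j <;> rw [hj]
      · exact (integrable_trig t a' b').comp_aemeasurable hm
      · exact (integrable_mul_trig hWmap t a' b').comp_aemeasurable hm
    · refine integral_steinOp_ncChiSqDiff hr h1 h2 (contDiff_trig t a b) (fun j _ => ?_)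
        (fun j _ => ?_) <;>
        obtain ⟨a', b', hj⟩ := exists_iteratedDeriv_trig t a b j <;> rw [hj]
      · exact integrable_trig t a' b'
      · exact integrable_mul_trig hT t a' b'

end
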